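/- Let S_1 ⊂ S_2 ⊂ ⋯ ⊂ S_N ⊂ I be rectangles with all inclusions strict. Then every basic move belonging to M_{S_1,…,S_N} is indispensable for the configuration A_{S_1,…,S_N}, i.e., for a basic move z = z⁺ − z⁻ in M_{S_1,…,S_N}, the fiber of A_{S_1,…,S_N} containing z⁺ is exactly {z⁺, z⁻}. -/

import Mathlib

open Finset

namespace Paper

abbrev Table (R C : ℕ) := Fin R × Fin C → ℤ

/-- The table with entry 1 in cell `a` and 0 elsewhere. -/
def e {R C : ℕ} (a : Fin R × Fin C) : Table R C := fun p => if p = a then 1 else 0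

/-- The l1-norm of an integer table. -/
def l1 {R C : ℕ} (z : Table R C) : ℤ := ∑ p : Fin R × Fin C, |z p|

/-- The configuration `A_{S_1,…,S_N}` : row sums, column sums and subtable sums. -/
def configMap {R C N : ℕ} (S : Fin N → Finset (Fin R × Fin C)) (z : Table R C) :
    (Fin R → ℤ) × (Fin C → ℤ) × (Fin N → ℤ) :=
  ⟨fun i => ∑ j, z (i, j), fun j => ∑ i, z (i, j), fun n => ∑ p ∈ S n, z p⟩

/-- A move for `A_{S_1,…,S_N}` : an integer table with vanishing row sums,
column sums and subtable sums. -/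
def IsMove {R C N : ℕ} (S : Fin N → Finset (Fin R × Fin C)) (z : Table R C) : Prop :=
  configMap S z = 0

/-- The fiber `F_t` of the configuration `A_{S_1,…,S_N}` : nonnegative integer tables
with prescribed row sums, column sums and subtable sums. -/
def Fiber {R C N : ℕ} (S : Fin N → Finset (Fin R × Fin C))
    (t : (Fin R → ℤ) × (Fin C → ℤ) × (Fin N → ℤ)) : Set (Table R C) :=
  {x | (∀ p, 0 ≤ x p) ∧ configMap S x = t}

/-- `B` is a Markov basis for the configuration `A_{S_1,…,S_N}`. -/
def IsMarkovBasis {R C N : ℕ} (S : Fin N → Finset (Fin R × Fin C))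
    (B : Set (Table R C)) : Prop :=
  B.Finite ∧ (∀ z ∈ B, IsMove S z) ∧ (∀ z ∈ B, -z ∈ B) ∧
    ∀ t, ∀ x ∈ Fiber S t, ∀ y ∈ Fiber S t, x ≠ y →
      ∃ U : ℕ, 0 < U ∧ ∃ zs : Fin U → Table R C,
        (∀ u, zs u ∈ B) ∧ y = x + ∑ u, zs u ∧
        ∀ u : Fin U, (x + ∑ s ∈ Finset.Iic u, zs s) ∈ Fiber S t

/-- `‖x − y‖₁` can be reduced by the set of moves `B` within the fiber `F`. -/
def CanReduce {R C : ℕ} (F : Set (Table R C)) (B : Set (Table R C))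
    (x y : Table R C) : Prop :=
  ∃ τp τm : ℕ, 0 < τp + τm ∧
    ∃ (Bp : Fin τp → Table R C) (Bm : Fin τm → Table R C),
      (∀ s, Bp s ∈ B) ∧ (∀ s, Bm s ∈ B) ∧
      (∀ u : Fin τp, (x + ∑ s ∈ Finset.Iic u, Bp s) ∈ F) ∧
      (∀ u : Fin τm, (y - ∑ s ∈ Finset.Iic u, Bm s) ∈ F) ∧
      l1 (x - y + ∑ s, Bp s + ∑ s, Bm s) < l1 (x - y)

/-- Basic moves (moves of Type I). -/
def IsBasicMove {R C : ℕ} (z : Table R C) : Prop :=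
  ∃ (i i' : Fin R) (j j' : Fin C), i ≠ i' ∧ j ≠ j' ∧
    z = e (i, j) + e (i', j') - e (i', j) - e (i, j')

/-- A rectangle in the set of cells. -/
def IsRectangle {R C : ℕ} (S : Finset (Fin R × Fin C)) : Prop :=
  ∃ (a₁ a₂ : Fin R) (b₁ b₂ : Fin C), a₁ < a₂ ∧ b₁ < b₂ ∧
    S = Finset.univ.filter fun p => a₁ ≤ p.1 ∧ p.1 ≤ a₂ ∧ b₁ ≤ p.2 ∧ p.2 ≤ b₂

/-- The positive part `z⁺` of a move. -/
def posPart {R C : ℕ} (z : Table R C) : Table R C := fun p => max (z p) 0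

/-- The negative part `z⁻` of a move. -/
def negPart {R C : ℕ} (z : Table R C) : Table R C := fun p => max (-z p) 0

/-- The `(k,l)` block `I_{kl}` (cells are 1-indexed in the paper, hence the `+ 1`). -/
def block {R C : ℕ} (rr cc : ℕ → ℕ) (k l : ℕ) : Finset (Fin R × Fin C) :=
  Finset.univ.filter fun p =>
    rr k ≤ p.1.1 + 1 ∧ p.1.1 + 1 < rr (k+1) ∧ cc l ≤ p.2.1 + 1 ∧ p.2.1 + 1 < cc (l+1)

/-- `S = I_{11} ∪ I_{22} ∪ ⋯ ∪ I_{NN}` : the union of the diagonal blocks. -/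
def Sdiag {R C : ℕ} (N : ℕ) (rr cc : ℕ → ℕ) : Finset (Fin R × Fin C) :=
  (Finset.Icc 1 N).biUnion fun k => block rr cc k k

/-- Two cells lie in a common block `I_{kl}` with `1 ≤ k,l ≤ Nb`. -/
def SameBlock {R C : ℕ} (Nb : ℕ) (rr cc : ℕ → ℕ) (p q : Fin R × Fin C) : Prop :=
  ∃ k l, 1 ≤ k ∧ k ≤ Nb ∧ 1 ≤ l ∧ l ≤ Nb ∧
    p ∈ block (R := R) (C := C) rr cc k l ∧ q ∈ block rr cc k l

/-- Two row indices lie in a common row block `[r_k, r_{k+1})`. -/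
def SameRowBlock {R : ℕ} (Nb : ℕ) (rr : ℕ → ℕ) (i i' : Fin R) : Prop :=
  ∃ k, 1 ≤ k ∧ k ≤ Nb ∧ rr k ≤ i.1 + 1 ∧ i.1 + 1 < rr (k+1) ∧
    rr k ≤ i'.1 + 1 ∧ i'.1 + 1 < rr (k+1)

/-- Moves of Type II: a degree-3 square-free move whose six nonzero cells
lie outside `S` and in six pairwise distinct blocks.  `Nd` bounds the index of the
diagonal blocks of `S`, `Nb` bounds the block indices. -/
def IsTypeII {R C : ℕ} (Nd Nb : ℕ) (rr cc : ℕ → ℕ) (z : Table R C) : Prop :=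
  ∃ (i₁ i₂ i₃ : Fin R) (j₁ j₂ j₃ : Fin C),
    z = e (i₁,j₂) + e (i₂,j₃) + e (i₃,j₁) - e (i₁,j₃) - e (i₂,j₁) - e (i₃,j₂) ∧
    (∀ p ∈ ([(i₁,j₂),(i₂,j₃),(i₃,j₁),(i₁,j₃),(i₂,j₁),(i₃,j₂)] : List (Fin R × Fin C)),
      p ∉ Sdiag Nd rr cc) ∧
    List.Pairwise (fun p q => ¬ SameBlock Nb rr cc p q)
      [(i₁,j₂),(i₂,j₃),(i₃,j₁),(i₁,j₃),(i₂,j₁),(i₃,j₂)]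

/-- Moves of Type III. -/
def IsTypeIII {R C : ℕ} (Nd Nb : ℕ) (rr cc : ℕ → ℕ) (z : Table R C) : Prop :=
  ∃ (i₁ i₂ i₃ : Fin R) (j₁ j₂ j₃ : Fin C),
    z = e (i₁,j₁) + e (i₂,j₃) + e (i₃,j₂) - e (i₁,j₃) - e (i₂,j₂) - e (i₃,j₁) ∧
    (∃ k l, 1 ≤ k ∧ k ≤ Nd ∧ 1 ≤ l ∧ l ≤ Nd ∧ k ≠ l ∧
      (i₁,j₁) ∈ block (R := R) (C := C) rr cc k k ∧ (i₂,j₂) ∈ block rr cc l l) ∧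
    (∀ p ∈ ([(i₂,j₃),(i₃,j₂),(i₁,j₃),(i₃,j₁)] : List (Fin R × Fin C)),
      p ∉ Sdiag Nd rr cc) ∧
    List.Pairwise (fun p q => ¬ SameBlock Nb rr cc p q) [(i₂,j₃),(i₃,j₂),(i₁,j₃),(i₃,j₁)]

/-- Moves of Type IV (row version). -/
def IsTypeIVrow {R C : ℕ} (Nd Nb : ℕ) (rr cc : ℕ → ℕ) (z : Table R C) : Prop :=
  ∃ (i₁ i₂ i₃ i₄ : Fin R) (j₁ j₂ j₃ j₄ : Fin C),
    z = e (i₁,j₁) + e (i₂,j₂) + e (i₃,j₃) + e (i₄,j₄)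
        - e (i₁,j₃) - e (i₂,j₄) - e (i₃,j₂) - e (i₄,j₁) ∧
    (∃ k l, 1 ≤ k ∧ k ≤ Nd ∧ 1 ≤ l ∧ l ≤ Nd ∧ k ≠ l ∧
      (i₁,j₁) ∈ block (R := R) (C := C) rr cc k k ∧ (i₃,j₂) ∈ block rr cc l l) ∧
    (∀ p ∈ ([(i₂,j₂),(i₃,j₃),(i₄,j₄),(i₁,j₃),(i₂,j₄),(i₄,j₁)] : List (Fin R × Fin C)),
      p ∉ Sdiag Nd rr cc) ∧
    SameRowBlock Nb rr i₁ i₂ ∧ SameRowBlock Nb rr i₃ i₄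

/-- Moves of Type IV, including the transposes of the row-version moves. -/
def IsTypeIV {R C : ℕ} (Nd Nb : ℕ) (rr cc : ℕ → ℕ) (z : Table R C) : Prop :=
  IsTypeIVrow Nd Nb rr cc z ∨
    IsTypeIVrow (R := C) (C := R) Nd Nb cc rr (fun p => z (p.2, p.1))

theorem e_row {R C : ℕ} (a : Fin R) (b : Fin C) (k : Fin R) :
    ∑ l, e (a, b) (k, l) = if k = a then 1 else 0 := by
  by_cases h : k = a <;> simp [e, h]

theorem e_col {R C : ℕ} (a : Fin R) (b : Fin C) (l : Fin C) :
    ∑ k, e (a, b) (k, l) = if l = b then 1 else 0 := by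
  by_cases h : l = b <;> simp [e, h]

theorem configMap_add {R C N : ℕ} (S : Fin N → Finset (Fin R × Fin C)) (x y : Table R C) :
    configMap S (x + y) = configMap S x + configMap S y := by
  simp only [configMap, Pi.add_apply, Finset.sum_add_distrib]
  rfl

theorem sum_two {n : ℕ} (f : Fin n → ℤ) (a b : Fin n) (hab : a ≠ b)
    (h : ∀ k, k ≠ a → k ≠ b → f k = 0) : ∑ k, f k = f a + f b := by
  rw [← Finset.sum_pair hab]
  symm
  apply Finset.sum_subset (Finset.subset_univ _)
  intro k _ hk
  simp only [Finset.mem_insert, Finset.mem_singleton, not_or] at hk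
  exact h k hk.1 hk.2

theorem fiber_basic {R C : ℕ} (x : Table R C) (hx : ∀ p, 0 ≤ x p)
    (i i' : Fin R) (j j' : Fin C) (hi : i ≠ i') (hj : j ≠ j')
    (hr : ∀ k, ∑ l, x (k, l) = (if k = i then 1 else 0) + (if k = i' then 1 else 0))
    (hc : ∀ l, ∑ k, x (k, l) = (if l = j then 1 else 0) + (if l = j' then 1 else 0)) :
    x = e (i, j) + e (i', j') ∨ x = e (i', j) + e (i, j') := by
  have zr : ∀ k l, k ≠ i → k ≠ i' → x (k, l) = 0 := by
    intro k l h1 h2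
    have := hr k
    simp only [h1, h2, if_false, add_zero] at this
    exact (Finset.sum_eq_zero_iff_of_nonneg (fun l _ => hx (k, l))).1 this l (Finset.mem_univ _)
  have zc : ∀ k l, l ≠ j → l ≠ j' → x (k, l) = 0 := by
    intro k l h1 h2
    have := hc l
    simp only [h1, h2, if_false, add_zero] at this
    exact (Finset.sum_eq_zero_iff_of_nonneg (fun k _ => hx (k, l))).1 this k (Finset.mem_univ _)
  have r1 := hr i
  have r2 := hr i'
  have c1 := hc j
  rw [sum_two _ j j' hj (fun l => zc _ l)] at r1 r2
  rw [sum_two _ i i' hi (fun k => zr k _)] at c1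
  simp only [hi, hi.symm, hj, if_true, if_false] at r1 r2 c1
  have n1 := hx (i, j)
  have n2 := hx (i, j')
  rcases (by omega : x (i, j) = 1 ∨ x (i, j) = 0) with h | h
  · left
    funext ⟨k, l⟩
    simp only [e, Pi.add_apply, Prod.mk.injEq]
    have := zr k l
    have := zc k l
    grind
  · right
    funext ⟨k, l⟩
    simp only [e, Pi.add_apply, Prod.mk.injEq]
    have := zr k l
    have := zc k l
    grind

/-- every basic move in `M_{S_1,…,S_N}` is indispensable for the
configuration of the change point model. -/
theorem changePoint_basicMoves_indispensable (R C N : ℕ) (hN : 1 ≤ N)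
    (S : ℕ → Finset (Fin R × Fin C))
    (hrect : ∀ n, 1 ≤ n → n ≤ N → IsRectangle (S n))
    (hchain : ∀ n m, 1 ≤ n → n < m → m ≤ N → S n ⊂ S m)
    (htop : S N ⊂ Finset.univ)
    (z : Table R C) (hbasic : IsBasicMove z)
    (hmove : IsMove (fun n : Fin N => S (n.1 + 1)) z) :
    Fiber (fun n : Fin N => S (n.1 + 1))
        (configMap (fun n : Fin N => S (n.1 + 1)) (posPart z)) =
      {posPart z, negPart z} := by
  obtain ⟨i, i', j, j', hi, hj, rfl⟩ := hbasic
  set z := e (i, j) + e (i', j') - e (i', j) - e (i, j') with hz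
  have hp : posPart z = e (i, j) + e (i', j') := by
    funext ⟨k, l⟩
    simp only [hz, posPart, e, Pi.add_apply, Pi.sub_apply, Prod.mk.injEq]
    grind
  have hn : negPart z = e (i', j) + e (i, j') := by
    funext ⟨k, l⟩
    simp only [hz, negPart, e, Pi.add_apply, Pi.sub_apply, Prod.mk.injEq]
    grind
  have hpn : posPart z = z + negPart z := by rw [hp, hn, hz]; abel
  ext x
  simp only [Fiber, Set.mem_setOf_eq, Set.mem_insert_iff, Set.mem_singleton_iff]
  constructor
  · rintro ⟨hx, hA⟩
    rw [hp] at hA ⊢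
    rw [hn]
    refine fiber_basic x hx i i' j j' hi hj (fun k => ?_) (fun l => ?_)
    · have := congrFun (congrArg Prod.fst hA) k
      simpa only [configMap, Pi.add_apply, Finset.sum_add_distrib, e_row] using this
    · have := congrFun (congrArg (fun t => t.2.1) hA) l
      simpa only [configMap, Pi.add_apply, Finset.sum_add_distrib, e_col] using this
  · rintro (rfl | rfl)
    · exact ⟨fun p => le_max_right _ _, rfl⟩
    · refine ⟨fun p => le_max_right _ _, ?_⟩
      rw [hpn, configMap_add, show configMap _ z = 0 from hmove, zero_add]

end Paper
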